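/- arXiv:1607.04699 — 5 statements merged into one kernel-verified Lean document; each statement's English description precedes it below -/
import Mathlib

section
/- For every integer m ≥ 29 and every real number N ≥ 1, (16/5)·2^{−m}·(exp(4π/√N) − 1) + (17/4)·(2π/√N)^{m−1}/(m−1)! + (7/2)·(m+1)·(2π/√N)^{m−1}/m! < exp(−2π/√N). -/
lemma pow_div_factorial_le_of_le {x y : ℝ} {k : ℕ} (hx : 0 ≤ x) (hxy : x ≤ y) (hyk : y ≤ k + 1)
    {n : ℕ} (hn : k ≤ n) :
    x ^ n / (n.factorial : ℝ) ≤ y ^ k / (k.factorial : ℝ) := by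
  induction n, hn using Nat.le_induction with
  | base => gcongr
  | succ n hn ih =>
    have hkn : (k : ℝ) ≤ n := by exact_mod_cast hn
    have hstep : x ^ (n + 1) / ((n + 1).factorial : ℝ)
        = x / ((n : ℝ) + 1) * (x ^ n / (n.factorial : ℝ)) := by
      rw [Nat.factorial_succ, pow_succ]
      push_cast
      field_simp
    have hratio : x / ((n : ℝ) + 1) ≤ 1 := by
      rw [div_le_one (by positivity)]
      linarith
    rw [hstep]
    exact (mul_le_of_le_one_left (by positivity) hratio).trans ih

lemma exp_lt_of_le_two_pi {x : ℝ} (hx : x ≤ 2 * Real.pi) : Real.exp x < 540 := by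
  have hpi := Real.pi_lt_d4
  have hone : Real.exp 6 < 404 := by
    have h : Real.exp 6 = Real.exp 1 ^ 6 := by rw [← Real.exp_nat_mul]; norm_num
    rw [h]
    calc Real.exp 1 ^ 6 < 2.7182818286 ^ 6 := by
          gcongr
          exact Real.exp_one_lt_d9
      _ < 404 := by norm_num
  have hfrac : Real.exp 0.2832 ≤ 1.334 := by
    have h : Real.exp 0.2832 = (Real.exp (-0.02832) ^ 10)⁻¹ := by
      rw [← Real.exp_nat_mul, ← Real.exp_neg]; norm_num
    have hlow : (1 - 0.02832 : ℝ) ≤ Real.exp (-0.02832) := Real.one_sub_le_exp_neg _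
    rw [h]
    calc (Real.exp (-0.02832) ^ 10)⁻¹ ≤ ((1 - 0.02832 : ℝ) ^ 10)⁻¹ := by
          gcongr
      _ ≤ 1.334 := by norm_num
  calc Real.exp x ≤ Real.exp (6 + 0.2832) := Real.exp_le_exp.mpr (by linarith)
    _ = Real.exp 6 * Real.exp 0.2832 := Real.exp_add _ _
    _ ≤ 404 * 1.334 := by gcongr
    _ < 540 := by norm_num

/-- Inequality (4.4) of the paper holds for all `m ≥ 29` and all levels `N ≥ 1`. -/
theorem even_weight_inequality_large_m :
    ∀ (m : ℕ), 29 ≤ m → ∀ (N : ℝ), 1 ≤ N →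
      (16 / 5) * (2 : ℝ) ^ (-(m : ℝ)) * (Real.exp (4 * Real.pi / Real.sqrt N) - 1)
        + (17 / 4) * (2 * Real.pi / Real.sqrt N) ^ (m - 1) / (Nat.factorial (m - 1) : ℝ)
        + (7 / 2) * ((m : ℝ) + 1) * (2 * Real.pi / Real.sqrt N) ^ (m - 1) / (Nat.factorial m : ℝ)
        < Real.exp (-(2 * Real.pi) / Real.sqrt N) := by
  intro m hm N hN
  have hsqrt : 1 ≤ Real.sqrt N := Real.one_le_sqrt.mpr hN
  have hpi := Real.pi_lt_d4
  have hdouble : 4 * Real.pi / Real.sqrt N = 2 * (2 * Real.pi / Real.sqrt N) := by ring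
  rw [hdouble, neg_div]
  have hx0 : 0 ≤ 2 * Real.pi / Real.sqrt N := by positivity
  have hx : 2 * Real.pi / Real.sqrt N ≤ 2 * Real.pi := div_le_self (by positivity) hsqrt
  generalize 2 * Real.pi / Real.sqrt N = x at hx0 hx ⊢
  obtain ⟨n, rfl⟩ : ∃ n, m = n + 1 := ⟨m - 1, by omega⟩
  have hexp := exp_lt_of_le_two_pi hx
  have hinv : (540 : ℝ)⁻¹ < Real.exp (-x) := by
    rw [Real.exp_neg]
    gcongr
  have hsq : Real.exp (2 * x) ≤ 540 ^ 2 := by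
    have h : Real.exp (2 * x) = Real.exp x ^ 2 := by rw [← Real.exp_nat_mul]; norm_num
    rw [h]
    gcongr
  have htwo : (2 : ℝ) ^ (-((n + 1 : ℕ) : ℝ)) ≤ (2 ^ 29)⁻¹ := by
    rw [Real.rpow_neg (by norm_num), Real.rpow_natCast]
    gcongr
    norm_num
  have hterm : x ^ n / (n.factorial : ℝ) ≤ 1 / 10 ^ 7 := by
    refine (pow_div_factorial_le_of_le (y := 6.2832) (k := 28) hx0 (by linarith) (by norm_num)
      (by omega)).trans ?_
    norm_num [Nat.factorial]
  have hfirst : (16 / 5) * (2 : ℝ) ^ (-((n + 1 : ℕ) : ℝ)) * (Real.exp (2 * x) - 1)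
      ≤ (16 / 5) * (2 ^ 29)⁻¹ * (540 ^ 2 - 1) := by
    have h : 0 ≤ Real.exp (2 * x) - 1 := by
      linarith [Real.add_one_le_exp (2 * x)]
    gcongr
  have hlast : (7 / 2) * (((n + 1 : ℕ) : ℝ) + 1) * x ^ n / ((n + 1).factorial : ℝ)
      ≤ 7 * (x ^ n / (n.factorial : ℝ)) := by
    have h : (7 / 2) * (((n + 1 : ℕ) : ℝ) + 1) * x ^ n / ((n + 1).factorial : ℝ)
        = (7 / 2) * (((n : ℝ) + 2) / (n + 1)) * (x ^ n / (n.factorial : ℝ)) := by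
      rw [Nat.factorial_succ]
      push_cast
      field_simp
      ring
    have hratio : ((n : ℝ) + 2) / (n + 1) ≤ 2 := by
      rw [div_le_iff₀ (by positivity)]
      linarith [(Nat.cast_nonneg n : (0 : ℝ) ≤ n)]
    rw [h]
    gcongr
    linarith
  rw [Nat.add_sub_cancel, mul_div_assoc (17 / 4 : ℝ)]
  have hnum : (16 / 5) * (2 ^ 29)⁻¹ * (540 ^ 2 - 1) + (17 / 4 + 7) * (1 / 10 ^ 7) < (540 : ℝ)⁻¹ := by
    norm_num
  linarith
end

section
/- For every integer m ≥ 3 and every real number N ≥ 433, (16/5)·2^{−m}·(exp(4π/√N) − 1) + (17/4)·(2π/√N)^{m−1}/(m−1)! + (7/2)·(m+1)·(2π/√N)^{m−1}/m! < exp(−2π/√N). -/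
theorem two_pi_div_sqrt_le {N : ℝ} (hN : 433 ≤ N) : 2 * Real.pi / Real.sqrt N ≤ 0.302 := by
  have hs : (20.808 : ℝ) ≤ Real.sqrt N := Real.le_sqrt_of_sq_le (by norm_num; linarith)
  rw [div_le_iff₀ (by linarith)]
  linarith [Real.pi_lt_d4]

theorem exp_302_le : Real.exp 0.302 ≤ 1.3526 := by
  refine (Real.exp_bound' (n := 6) (by norm_num) (by norm_num) (by norm_num)).trans ?_
  norm_num [Finset.sum_range_succ, Nat.factorial]

theorem pow_div_factorial_le {t : ℝ} (h0 : 0 ≤ t) (h1 : t ≤ 1) (n : ℕ) :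
    t ^ (n + 2) / ((n + 2).factorial : ℝ) ≤ t ^ 2 / 2 := by
  have hf : (2 : ℝ) ≤ ((n + 2).factorial : ℝ) := by
    exact_mod_cast Nat.factorial_le (Nat.le_add_left 2 n)
  have hp : t ^ (n + 2) ≤ t ^ 2 := pow_le_pow_of_le_one h0 h1 (Nat.le_add_left 2 n)
  gcongr

theorem succ_mul_pow_div_factorial_le {t : ℝ} (h0 : 0 ≤ t) (h1 : t ≤ 1) (n : ℕ) :
    ((n : ℝ) + 4) * t ^ (n + 2) / ((n + 3).factorial : ℝ) ≤ 2 / 3 * t ^ 2 := by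
  have hratio : ((n : ℝ) + 4) / (n + 3) ≤ 4 / 3 := by
    rw [div_le_div_iff₀ (by positivity) (by norm_num)]
    linarith [n.cast_nonneg (α := ℝ)]
  calc ((n : ℝ) + 4) * t ^ (n + 2) / ((n + 3).factorial : ℝ)
      = ((n : ℝ) + 4) / (n + 3) * (t ^ (n + 2) / ((n + 2).factorial : ℝ)) := by
        rw [Nat.factorial_succ (n + 2), div_mul_div_comm]
        push_cast
        ring
    _ ≤ 4 / 3 * (t ^ 2 / 2) :=
        mul_le_mul hratio (pow_div_factorial_le h0 h1 n) (by positivity) (by norm_num)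
    _ = 2 / 3 * t ^ 2 := by ring

theorem two_rpow_neg_le {m : ℕ} (hm : 3 ≤ m) : (2 : ℝ) ^ (-(m : ℝ)) ≤ 1 / 8 := by
  calc (2 : ℝ) ^ (-(m : ℝ)) ≤ (2 : ℝ) ^ (-((3 : ℕ) : ℝ)) := by
        gcongr
        norm_num
    _ = 1 / 8 := by
        rw [Real.rpow_neg (by norm_num), Real.rpow_natCast]
        norm_num

/-- Inequality (4.4) of the paper holds for all `m ≥ 3` and all levels `N ≥ 433`. -/
theorem even_weight_inequality_large_N :
    ∀ (m : ℕ), 3 ≤ m → ∀ (N : ℝ), 433 ≤ N →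
      (16 / 5) * (2 : ℝ) ^ (-(m : ℝ)) * (Real.exp (4 * Real.pi / Real.sqrt N) - 1)
        + (17 / 4) * (2 * Real.pi / Real.sqrt N) ^ (m - 1) / (Nat.factorial (m - 1) : ℝ)
        + (7 / 2) * ((m : ℝ) + 1) * (2 * Real.pi / Real.sqrt N) ^ (m - 1) / (Nat.factorial m : ℝ)
        < Real.exp (-(2 * Real.pi) / Real.sqrt N) := by
  intro m hm N hN
  have ht := two_pi_div_sqrt_le hN
  have ht0 : 0 ≤ 2 * Real.pi / Real.sqrt N := by positivity
  have h4 : 4 * Real.pi / Real.sqrt N = 2 * (2 * Real.pi / Real.sqrt N) := by ring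
  rw [h4, neg_div]
  generalize 2 * Real.pi / Real.sqrt N = t at ht ht0
  have ht1 : t ≤ 1 := by linarith
  have hE : Real.exp t ≤ 1.3526 := (Real.exp_le_exp.2 ht).trans exp_302_le
  have hneg : 1 / 1.3526 ≤ Real.exp (-t) := by
    rw [Real.exp_neg, ← one_div]
    exact one_div_le_one_div_of_le (Real.exp_pos t) hE
  have hexp : Real.exp (2 * t) - 1 ≤ 1.3526 ^ 2 - 1 := by
    rw [mul_comm, Real.exp_mul, Real.rpow_ofNat]
    gcongr
  have hexp0 : 0 ≤ Real.exp (2 * t) - 1 :=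
    sub_nonneg.2 (Real.one_le_exp (by positivity))
  have h2 : (2 : ℝ) ^ (-(m : ℝ)) * (Real.exp (2 * t) - 1) ≤ 1 / 8 * (1.3526 ^ 2 - 1) :=
    mul_le_mul (two_rpow_neg_le hm) hexp hexp0 (by norm_num)
  have hsq : t ^ 2 ≤ 0.302 ^ 2 := by gcongr
  obtain ⟨n, rfl⟩ := Nat.exists_eq_add_of_le' hm
  have hA := pow_div_factorial_le ht0 ht1 n
  have hB := succ_mul_pow_div_factorial_le ht0 ht1 n
  have hcast : ((n + 3 : ℕ) : ℝ) + 1 = n + 4 := by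
    push_cast
    ring
  rw [show n + 3 - 1 = n + 2 from rfl, hcast, mul_assoc, mul_div_assoc, mul_assoc (7 / 2 : ℝ),
    mul_div_assoc (7 / 2 : ℝ)]
  norm_num at hneg h2 hsq ⊢
  linarith
end

section
/- For every integer m ≥ 31 and every real number N ≥ 1, (7/2)·2^{−m}·(exp(4π/√N) − 1) + (m+2)·(2π/√N)^{m−1}·ζ(2)²/m! < exp(−2π/√N). -/
/-- The Riemann zeta function restricted to real arguments `x > 1`. -/
noncomputable def realZeta (x : ℝ) : ℝ := ∑' n : ℕ, 1 / ((n : ℝ) + 1) ^ x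

theorem realZeta_two : realZeta 2 = Real.pi ^ 2 / 6 := by
  have h := (hasSum_nat_add_iff' 1).mpr hasSum_zeta_two
  simp only [Finset.sum_range_one, Nat.cast_zero, ne_eq, OfNat.ofNat_ne_zero, not_false_eq_true,
    zero_pow, div_zero, sub_zero, Nat.cast_add, Nat.cast_one] at h
  rw [← h.tsum_eq, realZeta]
  exact tsum_congr fun n => by rw [Real.rpow_two]

theorem add_two_mul_pow_div_factorial_le (m : ℕ) (hm : 31 ≤ m) :
    ((m : ℝ) + 2) * (13 / 2) ^ (m - 1) / (Nat.factorial m : ℝ) ≤ 1 / 10 ^ 7 := by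
  induction m, hm using Nat.le_induction with
  | base => norm_num [Nat.factorial]
  | succ n hn ih =>
    obtain ⟨k, rfl⟩ : ∃ k, n = k + 1 := ⟨n - 1, by lia⟩
    refine le_trans ?_ ih
    have hf : (0 : ℝ) < (k + 1).factorial := by positivity
    have hk : (30 : ℝ) ≤ k := by exact_mod_cast (by lia : 30 ≤ k)
    have hp : (0 : ℝ) < (13 / 2) ^ k := by positivity
    rw [Nat.factorial_succ (k + 1), div_le_div_iff₀ (by positivity) hf]
    simp only [Nat.add_sub_cancel, pow_succ]
    push_cast
    have key : ((k : ℝ) + 1 + 1 + 2) * (13 / 2) ≤ (k + 1 + 2) * (k + 1 + 1) := by nlinarith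
    calc _ = (((k : ℝ) + 1 + 1 + 2) * (13 / 2)) * ((13 / 2) ^ k * (k + 1).factorial) := by ring
      _ ≤ ((k + 1 + 2) * (k + 1 + 1)) * ((13 / 2) ^ k * (k + 1).factorial) := by gcongr
      _ = _ := by ring

theorem exp_thirteen_le : Real.exp 13 ≤ 490000 := by
  have h : Real.exp 13 = Real.exp 1 ^ 13 := by rw [← Real.exp_nat_mul]; norm_num
  rw [h]
  calc Real.exp 1 ^ 13 ≤ 2.7183 ^ 13 := by
        gcongr
        linarith [Real.exp_one_lt_d9]
    _ ≤ 490000 := by norm_num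

/-- Inequality (5.3) of the paper holds for all `m ≥ 31` and all levels `N ≥ 1`. -/
theorem odd_weight_inequality_large_m :
    ∀ (m : ℕ), 31 ≤ m → ∀ (N : ℝ), 1 ≤ N →
      (7 / 2) * (2 : ℝ) ^ (-(m : ℝ)) * (Real.exp (4 * Real.pi / Real.sqrt N) - 1)
        + ((m : ℝ) + 2) * (2 * Real.pi / Real.sqrt N) ^ (m - 1) * realZeta 2 ^ 2
            / (Nat.factorial m : ℝ)
        < Real.exp (-(2 * Real.pi) / Real.sqrt N) := by
  intro m hm N hN
  have hs : 1 ≤ Real.sqrt N := Real.one_le_sqrt.mpr hN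
  set t := 2 * Real.pi / Real.sqrt N with ht
  have ht0 : 0 ≤ t := by positivity
  have ht1 : t ≤ 13 / 2 := by
    have : t ≤ 2 * Real.pi := div_le_self (by positivity) hs
    linarith [Real.pi_lt_d2]
  have h4 : 4 * Real.pi / Real.sqrt N = 2 * t := by rw [ht]; ring
  rw [h4, neg_div, ← ht]
  have hexp : Real.exp (2 * t) ≤ 490000 :=
    (Real.exp_le_exp.mpr (by linarith)).trans exp_thirteen_le
  have hrhs : 1 / 700 ≤ Real.exp (-t) := by
    have hsq : Real.exp t ^ 2 = Real.exp (2 * t) := by rw [← Real.exp_nat_mul]; norm_num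
    have h700 : Real.exp t ≤ 700 := by nlinarith [Real.exp_pos t]
    rw [Real.exp_neg, ← one_div]
    exact one_div_le_one_div_of_le (Real.exp_pos t) h700
  have hpow : (2 : ℝ) ^ (-(m : ℝ)) ≤ 1 / 2 ^ 31 := by
    rw [Real.rpow_neg zero_le_two, Real.rpow_natCast, ← one_div]
    exact one_div_le_one_div_of_le (by positivity) (pow_le_pow_right₀ one_le_two hm)
  have hfirst : (7 / 2) * (2 : ℝ) ^ (-(m : ℝ)) * (Real.exp (2 * t) - 1)
      ≤ (7 / 2) * (1 / 2 ^ 31) * 490000 := by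
    have : 0 ≤ Real.exp (2 * t) - 1 := by linarith [Real.add_one_le_exp (2 * t)]
    gcongr
    linarith
  have hzeta : realZeta 2 ^ 2 ≤ 4 := by
    have h : realZeta 2 ≤ 2 := by
      rw [realZeta_two]
      nlinarith [Real.pi_lt_d2, Real.pi_pos]
    have h0 : 0 ≤ realZeta 2 := by rw [realZeta_two]; positivity
    nlinarith
  have hsecond : ((m : ℝ) + 2) * t ^ (m - 1) * realZeta 2 ^ 2 / (Nat.factorial m : ℝ)
      ≤ 4 / 10 ^ 7 := by
    calc _ ≤ ((m : ℝ) + 2) * (13 / 2) ^ (m - 1) * 4 / (Nat.factorial m : ℝ) := by gcongr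
      _ = 4 * (((m : ℝ) + 2) * (13 / 2) ^ (m - 1) / (Nat.factorial m : ℝ)) := by ring
      _ ≤ 4 * (1 / 10 ^ 7) :=
        mul_le_mul_of_nonneg_left (add_two_mul_pow_div_factorial_le m hm) (by norm_num)
      _ = _ := by ring
  norm_num at hfirst hsecond ⊢
  linarith
end

section
/- For all real numbers x, y with 2 ≤ x ≤ y, one has 2^y·(ζ(1/2 + y)² − 1) ≤ 2^x·(ζ(1/2 + x)² − 1); that is, the function x ↦ 2^x·(ζ(1/2 + x)² − 1) is weakly decreasing on [2, ∞). -/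
theorem summable_one_div_nat_add_one_rpow {s : ℝ} (hs : 1 < s) :
    Summable fun n : ℕ => 1 / ((n : ℝ) + 1) ^ s := by
  have h := (summable_nat_add_iff 1).2 (Real.summable_one_div_nat_rpow.2 hs)
  simpa using h

theorem summable_one_div_nat_add_two_rpow {s : ℝ} (hs : 1 < s) :
    Summable fun n : ℕ => 1 / ((n : ℝ) + 2) ^ s := by
  have h := (summable_nat_add_iff 2).2 (Real.summable_one_div_nat_rpow.2 hs)
  simpa using h

theorem realZeta_sub_one {s : ℝ} (hs : 1 < s) :
    realZeta s - 1 = ∑' n : ℕ, 1 / ((n : ℝ) + 2) ^ s := by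
  have h := (summable_one_div_nat_add_one_rpow hs).tsum_eq_zero_add
  rw [realZeta, h]
  simp only [Nat.cast_zero, zero_add, Real.one_rpow, div_one, add_sub_cancel_left]
  congr 1 with n
  push_cast
  ring_nf

theorem one_le_realZeta {s : ℝ} (hs : 1 < s) : 1 ≤ realZeta s := by
  rw [← sub_nonneg, realZeta_sub_one hs]
  exact tsum_nonneg fun n => by positivity

theorem realZeta_anti {s t : ℝ} (hs : 1 < s) (hst : s ≤ t) : realZeta t ≤ realZeta s := by
  refine (summable_one_div_nat_add_one_rpow (hs.trans_le hst)).tsum_le_tsum (fun n => ?_)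
    (summable_one_div_nat_add_one_rpow hs)
  have h : (1 : ℝ) ≤ n + 1 := by simp
  gcongr

theorem two_rpow_mul_realZeta_sub_one_anti {c x y : ℝ} (hx : 1 < c + x) (hxy : x ≤ y) :
    (2 : ℝ) ^ y * (realZeta (c + y) - 1) ≤ (2 : ℝ) ^ x * (realZeta (c + x) - 1) := by
  have hy : 1 < c + y := by linarith
  rw [realZeta_sub_one hx, realZeta_sub_one hy, ← tsum_mul_left, ← tsum_mul_left]
  refine ((summable_one_div_nat_add_two_rpow hy).mul_left _).tsum_le_tsum (fun n => ?_)
    ((summable_one_div_nat_add_two_rpow hx).mul_left _)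
  have hn : (0 : ℝ) < n + 2 := by positivity
  rw [mul_one_div, mul_one_div, div_le_div_iff₀ (by positivity) (by positivity)]
  have h : (2 : ℝ) ^ (y - x) ≤ (n + 2 : ℝ) ^ (y - x) :=
    Real.rpow_le_rpow zero_le_two (by simp) (by linarith)
  calc (2 : ℝ) ^ y * (n + 2 : ℝ) ^ (c + x)
      = (2 : ℝ) ^ x * (2 : ℝ) ^ (y - x) * (n + 2 : ℝ) ^ (c + x) := by
        rw [← Real.rpow_add two_pos]; ring_nf
    _ ≤ (2 : ℝ) ^ x * (n + 2 : ℝ) ^ (y - x) * (n + 2 : ℝ) ^ (c + x) := by gcongr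
    _ = (2 : ℝ) ^ x * (n + 2 : ℝ) ^ (c + y) := by
        rw [mul_assoc, ← Real.rpow_add hn]; ring_nf

/-- The function `x ↦ 2^x (ζ(1/2 + x)² − 1)` is weakly decreasing on `[2, ∞)`. -/
theorem two_pow_zeta_half_decreasing :
    ∀ x y : ℝ, 2 ≤ x → x ≤ y →
      (2 : ℝ) ^ y * (realZeta (1 / 2 + y) ^ 2 - 1) ≤
        (2 : ℝ) ^ x * (realZeta (1 / 2 + x) ^ 2 - 1) := by
  intro x y hx hxy
  have hx' : 1 < 1 / 2 + x := by linarith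
  have hy' : 1 < 1 / 2 + y := by linarith
  have h1 := one_le_realZeta hx'
  have h2 := one_le_realZeta hy'
  have h3 : realZeta (1 / 2 + y) ≤ realZeta (1 / 2 + x) := realZeta_anti hx' (by linarith)
  have h := mul_le_mul (two_rpow_mul_realZeta_sub_one_anti hx' hxy)
    (add_le_add_left h3 1) (by linarith)
    (mul_nonneg (by positivity) (sub_nonneg.2 h1))
  linear_combination h
end

section
/- For all real numbers x, y with 1 ≤ x ≤ y, one has 2^y·(ζ(1 + y)² − 1) ≤ 2^x·(ζ(1 + x)² − 1); that is, the function x ↦ 2^x·(ζ(1 + x)² − 1) is weakly decreasing on [1, ∞). -/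
/-- The tail `ζ(s) - 1` of the zeta function. -/
noncomputable def realZetaTail (s : ℝ) : ℝ := ∑' n : ℕ, 1 / ((n : ℝ) + 2) ^ s

theorem realZeta_eq_one_add_tail {s : ℝ} (hs : 1 < s) :
    realZeta s = 1 + realZetaTail s := by
  rw [realZeta, (summable_one_div_nat_add_one_rpow hs).tsum_eq_zero_add, realZetaTail]
  congr 1
  · simp
  · refine tsum_congr fun n => ?_
    push_cast
    rw [add_assoc, one_add_one_eq_two]

theorem realZetaTail_nonneg (s : ℝ) : 0 ≤ realZetaTail s :=
  tsum_nonneg fun _ => by positivity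

theorem realZetaTail_anti {s t : ℝ} (hs : 1 < s) (hst : s ≤ t) :
    realZetaTail t ≤ realZetaTail s := by
  refine (summable_one_div_nat_add_two_rpow (hs.trans_le hst)).tsum_le_tsum (fun n => ?_)
    (summable_one_div_nat_add_two_rpow hs)
  have hn : (0 : ℝ) ≤ n := n.cast_nonneg
  exact one_div_le_one_div_of_le (by positivity)
    (Real.rpow_le_rpow_of_exponent_le (by linarith) hst)

theorem two_rpow_mul_realZetaTail_anti {x y : ℝ} (hx : 0 < x) (hxy : x ≤ y) :
    (2 : ℝ) ^ y * realZetaTail (1 + y) ≤ (2 : ℝ) ^ x * realZetaTail (1 + x) := by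
  simp only [realZetaTail, ← tsum_mul_left]
  refine ((summable_one_div_nat_add_two_rpow (by linarith)).mul_left _).tsum_le_tsum
    (fun n => ?_) ((summable_one_div_nat_add_two_rpow (by linarith)).mul_left _)
  have hn : (0 : ℝ) < (n : ℝ) + 2 := by positivity
  have key (z : ℝ) : (2 : ℝ) ^ z * (1 / ((n : ℝ) + 2) ^ (1 + z)) =
      (2 / ((n : ℝ) + 2)) ^ z * (1 / ((n : ℝ) + 2)) := by
    rw [Real.rpow_add hn, Real.rpow_one, Real.div_rpow zero_le_two hn.le]
    field_simp
  rw [key, key]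
  refine mul_le_mul_of_nonneg_right ?_ (by positivity)
  refine Real.rpow_le_rpow_of_exponent_ge (by positivity) ?_ hxy
  rw [div_le_one hn]
  linarith [(n.cast_nonneg : (0 : ℝ) ≤ n)]

/-- The function `x ↦ 2^x (ζ(1 + x)² − 1)` is weakly decreasing on `[1, ∞)`. -/
theorem two_pow_zeta_one_decreasing :
    ∀ x y : ℝ, 1 ≤ x → x ≤ y →
      (2 : ℝ) ^ y * (realZeta (1 + y) ^ 2 - 1) ≤
        (2 : ℝ) ^ x * (realZeta (1 + x) ^ 2 - 1) := by
  intro x y hx hxy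
  have factor (z : ℝ) (hz : 1 ≤ z) : (2 : ℝ) ^ z * (realZeta (1 + z) ^ 2 - 1) =
      (2 : ℝ) ^ z * realZetaTail (1 + z) * (2 + realZetaTail (1 + z)) := by
    rw [realZeta_eq_one_add_tail (by linarith)]
    ring
  rw [factor x hx, factor y (hx.trans hxy)]
  have hTx := realZetaTail_nonneg (1 + x)
  have hTy := realZetaTail_nonneg (1 + y)
  have hT : realZetaTail (1 + y) ≤ realZetaTail (1 + x) :=
    realZetaTail_anti (by linarith) (by linarith)
  exact mul_le_mul (two_rpow_mul_realZetaTail_anti (by linarith) hxy) (by linarith)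
    (by positivity) (by positivity)
end
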